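/- For a = a₁X₇+a₂X₈+a₃X₉ with real coefficients, the set of eigenvalues of the adjoint map ad(a) : 𝔰𝔲(4) → 𝔰𝔲(4), h ↦ [a,h], restricted to its nonzero values on the root spaces, is {±i(a₂−a₃), ±i(a₂+a₃), ±i(a₁−a₃), ±i(a₁+a₃), ±i(a₁+a₂), ±i(a₁−a₂)} (each with multiplicity one), together with eigenvalue 0 with multiplicity 3. -/

import Mathlib

open Matrix Kronecker Complex Polynomial

noncomputable def sigma1 : Matrix (Fin 2) (Fin 2) ℂ := !![0, 1; 1, 0]
noncomputable def sigma2 : Matrix (Fin 2) (Fin 2) ℂ := !![0, -I; I, 0]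
noncomputable def sigma3 : Matrix (Fin 2) (Fin 2) ℂ := !![1, 0; 0, -1]

noncomputable def X7 : Matrix (Fin 2 × Fin 2) (Fin 2 × Fin 2) ℂ := (I / 2) • (sigma1 ⊗ₖ sigma1)
noncomputable def X8 : Matrix (Fin 2 × Fin 2) (Fin 2 × Fin 2) ℂ := (I / 2) • (sigma2 ⊗ₖ sigma2)
noncomputable def X9 : Matrix (Fin 2 × Fin 2) (Fin 2 × Fin 2) ℂ := (I / 2) • (sigma3 ⊗ₖ sigma3)

/-- The traceless matrices `𝔰𝔩(4,ℂ)`, the complexification of `𝔰𝔲(4)`. -/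
noncomputable def sl4 : Submodule ℂ (Matrix (Fin 2 × Fin 2) (Fin 2 × Fin 2) ℂ) :=
  LinearMap.ker (Matrix.traceLinearMap (Fin 2 × Fin 2) ℂ ℂ)

/-- The adjoint map `ad(a) : h ↦ [a,h] = ah − ha` as a linear endomorphism. -/
noncomputable def adMap (a : Matrix (Fin 2 × Fin 2) (Fin 2 × Fin 2) ℂ) :
    Matrix (Fin 2 × Fin 2) (Fin 2 × Fin 2) ℂ →ₗ[ℂ]
      Matrix (Fin 2 × Fin 2) (Fin 2 × Fin 2) ℂ :=
  LinearMap.mulLeft ℂ a - LinearMap.mulRight ℂ a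

noncomputable def bellP : Matrix (Fin 2 × Fin 2) (Fin 2 × Fin 2) ℂ := fun i j =>
  !![!![1, 0; 0, 1] i.1 i.2, !![1, 0; 0, -1] i.1 i.2;
     !![0, 1; 1, 0] i.1 i.2, !![0, 1; -1, 0] i.1 i.2] j.1 j.2

noncomputable def bellQ : Matrix (Fin 2 × Fin 2) (Fin 2 × Fin 2) ℂ := (1 / 2 : ℂ) • bellPᵀ

noncomputable def bellD (a1 a2 a3 : ℂ) : Fin 2 × Fin 2 → ℂ := fun j =>
  (I / 2) * !![a1 - a2 + a3, -a1 + a2 + a3; a1 + a2 - a3, -a1 - a2 - a3] j.1 j.2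

lemma bell_PQ : bellP * bellQ = 1 := by
  ext ⟨i1, i2⟩ ⟨j1, j2⟩
  fin_cases i1 <;> fin_cases i2 <;> fin_cases j1 <;> fin_cases j2 <;>
    simp [bellQ, bellP, Matrix.mul_apply, Fintype.sum_prod_type, Matrix.one_apply] <;> norm_num

lemma bell_QP : bellQ * bellP = 1 := mul_eq_one_comm.mp bell_PQ

lemma bell_aP (a1 a2 a3 : ℂ) :
    (a1 • X7 + a2 • X8 + a3 • X9) * bellP = bellP * diagonal (bellD a1 a2 a3) := by
  ext ⟨i1, i2⟩ ⟨j1, j2⟩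
  rw [Matrix.mul_diagonal]
  fin_cases i1 <;> fin_cases i2 <;> fin_cases j1 <;> fin_cases j2 <;>
    simp [bellD, bellP, X7, X8, X9, sigma1, sigma2, sigma3, Matrix.mul_apply,
      Fintype.sum_prod_type] <;> ring

lemma bell_Qa (a1 a2 a3 : ℂ) :
    bellQ * (a1 • X7 + a2 • X8 + a3 • X9) = diagonal (bellD a1 a2 a3) * bellQ := by
  calc bellQ * (a1 • X7 + a2 • X8 + a3 • X9)
      = bellQ * ((a1 • X7 + a2 • X8 + a3 • X9) * bellP) * bellQ := by
        rw [Matrix.mul_assoc, Matrix.mul_assoc, bell_PQ, Matrix.mul_one]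
    _ = _ := by rw [bell_aP, ← Matrix.mul_assoc, bell_QP, Matrix.one_mul]

abbrev BellS := {p : (Fin 2 × Fin 2) × (Fin 2 × Fin 2) // p ≠ ((1, 1), (1, 1))}

noncomputable def bellL : sl4 →ₗ[ℂ] (BellS → ℂ) where
  toFun x := fun p => (bellQ * x.1 * bellP) p.1.1 p.1.2
  map_add' x y := by
    ext p
    simp [Matrix.mul_add, Matrix.add_mul]
  map_smul' c x := by
    ext p
    simp

lemma bellL_inj : Function.Injective bellL := by
  rw [← LinearMap.ker_eq_bot, LinearMap.ker_eq_bot']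
  rintro ⟨x, hx⟩ h0
  have hx' : x.trace = 0 := by simpa [sl4] using hx
  have h1 : ∀ p : BellS, (bellQ * x * bellP) p.1.1 p.1.2 = 0 := fun p => congrFun h0 p
  have ht : (bellQ * x * bellP).trace = 0 := by
    rw [Matrix.trace_mul_comm, ← Matrix.mul_assoc, bell_PQ, Matrix.one_mul, hx']
  have h2 : bellQ * x * bellP = 0 := by
    ext i j
    by_cases hp : (i, j) ≠ (((1, 1), (1, 1)) : (Fin 2 × Fin 2) × (Fin 2 × Fin 2))
    · exact h1 ⟨(i, j), hp⟩
    · push Not at hp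
      obtain ⟨rfl, rfl⟩ := Prod.mk.inj hp
      have e1 := h1 ⟨((0, 0), (0, 0)), by decide⟩
      have e2 := h1 ⟨((0, 1), (0, 1)), by decide⟩
      have e3 := h1 ⟨((1, 0), (1, 0)), by decide⟩
      simp only [Matrix.trace, Matrix.diag, Fintype.sum_prod_type, Fin.sum_univ_two] at ht
      simp only at e1 e2 e3
      rw [e1, e2, e3] at ht
      simpa using ht
  have h3 : x = 0 := by
    calc x = (bellP * bellQ) * x * (bellP * bellQ) := by simp [bell_PQ]
      _ = bellP * (bellQ * x * bellP) * bellQ := by simp only [Matrix.mul_assoc]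
      _ = 0 := by simp [h2]
  exact Subtype.ext h3

lemma bell_finrank : Module.finrank ℂ sl4 = Module.finrank ℂ (BellS → ℂ) := by
  have h1 : Matrix.traceLinearMap (Fin 2 × Fin 2) ℂ ℂ ≠ 0 := by
    intro h
    have := congrArg (fun f => f 1) h
    simp at this
  have h2 := Module.Dual.finrank_ker_add_one_of_ne_zero (K := ℂ) h1
  have h3 : Module.finrank ℂ (BellS → ℂ) = 15 := by
    rw [Module.finrank_fintype_fun_eq_card]
    decide
  rw [Module.finrank_matrix] at h2
  simp at h2
  rw [h3]
  exact h2

noncomputable def bellE : sl4 ≃ₗ[ℂ] (BellS → ℂ) :=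
  LinearEquiv.ofInjectiveOfFinrankEq bellL bellL_inj bell_finrank

/-- For `a = a₁X₇ + a₂X₈ + a₃X₉`, the eigenvalues of `ad(a)` (computed over the
complexification of `𝔰𝔲(4)`) are `0` with multiplicity `3` together with
`±i(a₂−a₃), ±i(a₂+a₃), ±i(a₁−a₃), ±i(a₁+a₃), ±i(a₁+a₂), ±i(a₁−a₂)`,
each with multiplicity one; equivalently the characteristic polynomial of
`ad(a)` restricted to the complexification factors accordingly. -/
theorem stmt19 (a1 a2 a3 : ℝ)
    (h : ∀ x ∈ sl4, adMap ((a1 : ℂ) • X7 + (a2 : ℂ) • X8 + (a3 : ℂ) • X9) x ∈ sl4) :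
    LinearMap.charpoly
        ((adMap ((a1 : ℂ) • X7 + (a2 : ℂ) • X8 + (a3 : ℂ) • X9)).restrict h) =
      X ^ 3 *
        ((X - C (I * ((a2 : ℂ) - a3))) * (X + C (I * ((a2 : ℂ) - a3))) *
          (X - C (I * ((a2 : ℂ) + a3))) * (X + C (I * ((a2 : ℂ) + a3))) *
          (X - C (I * ((a1 : ℂ) - a3))) * (X + C (I * ((a1 : ℂ) - a3))) *
          (X - C (I * ((a1 : ℂ) + a3))) * (X + C (I * ((a1 : ℂ) + a3))) *
          (X - C (I * ((a1 : ℂ) + a2))) * (X + C (I * ((a1 : ℂ) + a2))) *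
          (X - C (I * ((a1 : ℂ) - a2))) * (X + C (I * ((a1 : ℂ) - a2)))) := by
  set f := (adMap ((a1 : ℂ) • X7 + (a2 : ℂ) • X8 + (a3 : ℂ) • X9)).restrict h with hf
  set d := bellD a1 a2 a3 with hd
  have hE : ∀ x, bellE x = bellL x := fun x => rfl
  have hconj : bellE.conj f = (diagonal (fun p : BellS => d p.1.1 - d p.1.2)).toLin' := by
    apply LinearMap.ext
    intro g
    obtain ⟨x, rfl⟩ := bellE.surjective g
    rw [LinearEquiv.conj_apply_apply, LinearEquiv.symm_apply_apply, hE, hE]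
    ext p
    rw [Matrix.toLin'_apply, Matrix.mulVec_diagonal]
    change (bellQ * (((a1 : ℂ) • X7 + (a2 : ℂ) • X8 + (a3 : ℂ) • X9) * x.1 -
      x.1 * ((a1 : ℂ) • X7 + (a2 : ℂ) • X8 + (a3 : ℂ) • X9)) * bellP) p.1.1 p.1.2 =
      (d p.1.1 - d p.1.2) * (bellQ * x.1 * bellP) p.1.1 p.1.2
    rw [Matrix.mul_sub, Matrix.sub_mul, ← Matrix.mul_assoc, bell_Qa, Matrix.mul_assoc bellQ,
      Matrix.mul_assoc x.1, bell_aP, Matrix.mul_assoc (diagonal _),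
      Matrix.mul_assoc (diagonal _), ← Matrix.mul_assoc x.1,
      ← Matrix.mul_assoc bellQ (_ * _) (diagonal _), Matrix.sub_apply, Matrix.diagonal_mul,
      Matrix.mul_diagonal, ← Matrix.mul_assoc bellQ]
    ring
  rw [← LinearEquiv.charpoly_conj bellE f, hconj, Matrix.charpoly_toLin',
    Matrix.charpoly_diagonal]
  apply mul_left_cancel₀ (X_ne_zero (R := ℂ))
  have key := Fintype.prod_eq_mul_prod_subtype_ne
    (fun p : (Fin 2 × Fin 2) × (Fin 2 × Fin 2) => (X - C (d p.1 - d p.2) : ℂ[X]))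
    ((1, 1), (1, 1))
  simp only [sub_self, map_zero, sub_zero] at key
  refine key.symm.trans ?_
  have c2 : (C (I / 2) : ℂ[X]) * 2 = C I := by
    rw [show (2 : ℂ[X]) = C 2 from rfl, ← C_mul]
    simp
  simp only [Fintype.prod_prod_type, Fin.prod_univ_two, hd, bellD, Matrix.of_apply,
    Matrix.cons_val', Matrix.cons_val_zero, Matrix.cons_val_one, sub_self, map_zero, sub_zero,
    map_sub, map_add, map_mul, map_neg, Matrix.cons_val_fin_one]
  rw [← c2]
  ring
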